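/- arXiv:1701.06307 — 9 statements merged into one kernel-verified Lean document; each statement's English description precedes it below -/
import Mathlib

section
/- Let A be an n×n nonnegative real matrix, L[A] its Laplacian, and Γ = diag(γ₁,…,γₙ) with γᵢ ≥ 0. Then the matrix −(L[A]+Γ) is Hurwitz stable (every eigenvalue has negative real part) if and only if every agent i ∈ {1,…,n} is P-dependent. -/
open Matrix

/-- The Laplacian of a nonnegative matrix `A`. -/
def Lap {n : ℕ} (A : Matrix (Fin n) (Fin n) ℝ) : Matrix (Fin n) (Fin n) ℝ :=
  Matrix.of fun i j => if i = j then ∑ k ∈ Finset.univ.erase i, A i k else -A i j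

/-- Agent `i` is P-dependent: either `γ i > 0`, or there is a walk in the graph of
positive entries of `A` from `i` to some agent `j` with `γ j > 0`. -/
def PDep {n : ℕ} (A : Matrix (Fin n) (Fin n) ℝ) (γ : Fin n → ℝ) (i : Fin n) : Prop :=
  ∃ j, Relation.ReflTransGen (fun p q => 0 < A p q) i j ∧ 0 < γ j

/-- A real square matrix is Hurwitz stable: every complex eigenvalue has negative real part. -/
def Hurwitz {n : ℕ} (M : Matrix (Fin n) (Fin n) ℝ) : Prop :=
  ∀ μ ∈ spectrum ℂ (M.map (algebraMap ℝ ℂ)), μ.re < 0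

theorem neg_lap_add_diagonal_mulVec {n : ℕ} (A : Matrix (Fin n) (Fin n) ℝ) (γ : Fin n → ℝ)
    (v : Fin n → ℂ) (i : Fin n) :
    ((-(Lap A + Matrix.diagonal γ)).map (algebraMap ℝ ℂ) *ᵥ v) i =
      ∑ k ∈ Finset.univ.erase i, (A i k : ℂ) * v k
        - ((∑ k ∈ Finset.univ.erase i, A i k + γ i : ℝ) : ℂ) * v i := by
  rw [Matrix.mulVec, dotProduct, ← Finset.add_sum_erase _ _ (Finset.mem_univ i)]
  have h : ∀ k ∈ Finset.univ.erase i,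
      (-(Lap A + Matrix.diagonal γ)).map (algebraMap ℝ ℂ) i k * v k = (A i k : ℂ) * v k := by
    intro k hk
    have hne : i ≠ k := (Finset.ne_of_mem_erase hk).symm
    simp [Lap, hne]
  rw [Finset.sum_congr rfl h]
  simp [Lap]
  ring

/-- If `v` is an eigenvector for an eigenvalue with nonnegative real part, then an agent where
`‖v‖` is maximal is not prejudiced, and `‖v‖` is also maximal at each of its neighbours. -/
theorem eq_zero_and_norm_eq_of_norm_max {n : ℕ} {A : Matrix (Fin n) (Fin n) ℝ}
    (hA : ∀ i j, 0 ≤ A i j) {γ : Fin n → ℝ} (hγ : ∀ i, 0 ≤ γ i) {μ : ℂ} (hμ : 0 ≤ μ.re)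
    {v : Fin n → ℂ} {m : ℝ} (hm : 0 < m) (hv : ∀ i, ‖v i‖ ≤ m)
    (hev : (-(Lap A + Matrix.diagonal γ)).map (algebraMap ℝ ℂ) *ᵥ v = μ • v)
    {i : Fin n} (hi : ‖v i‖ = m) :
    γ i = 0 ∧ ∀ j, 0 < A i j → ‖v j‖ = m := by
  have h := congrFun hev i
  rw [neg_lap_add_diagonal_mulVec] at h
  set d := ∑ k ∈ Finset.univ.erase i, A i k with hd
  have h1 : (μ + ((d + γ i : ℝ) : ℂ)) * v i = ∑ k ∈ Finset.univ.erase i, (A i k : ℂ) * v k := by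
    simp only [Pi.smul_apply, smul_eq_mul] at h
    linear_combination -h
  have h2 : d + γ i ≤ ‖μ + ((d + γ i : ℝ) : ℂ)‖ := by
    refine le_trans ?_ (Complex.re_le_norm _)
    rw [Complex.add_re, Complex.ofReal_re]
    linarith
  have h3 : (d + γ i) * m ≤ ∑ k ∈ Finset.univ.erase i, A i k * ‖v k‖ := by
    calc (d + γ i) * m ≤ ‖μ + ((d + γ i : ℝ) : ℂ)‖ * ‖v i‖ := by rw [hi]; gcongr
      _ = ‖∑ k ∈ Finset.univ.erase i, (A i k : ℂ) * v k‖ := by rw [← norm_mul, h1]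
      _ ≤ ∑ k ∈ Finset.univ.erase i, ‖(A i k : ℂ) * v k‖ := norm_sum_le _ _
      _ = ∑ k ∈ Finset.univ.erase i, A i k * ‖v k‖ := by
        refine Finset.sum_congr rfl fun k _ => ?_
        rw [norm_mul, Complex.norm_real, Real.norm_of_nonneg (hA i k)]
  have h4 : ∀ k ∈ Finset.univ.erase i, 0 ≤ A i k * (m - ‖v k‖) := fun k _ =>
    mul_nonneg (hA i k) (sub_nonneg.2 (hv k))
  have h5 : ∑ k ∈ Finset.univ.erase i, A i k * (m - ‖v k‖)
      = d * m - ∑ k ∈ Finset.univ.erase i, A i k * ‖v k‖ := by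
    simp only [mul_sub, Finset.sum_sub_distrib, hd, Finset.sum_mul]
  have h6 := Finset.sum_nonneg h4
  have h7 : 0 ≤ γ i * m := mul_nonneg (hγ i) hm.le
  have h8 : γ i * m = 0 := by linarith
  have h9 : ∑ k ∈ Finset.univ.erase i, A i k * (m - ‖v k‖) = 0 := by linarith
  refine ⟨(mul_eq_zero.1 h8).resolve_right hm.ne', fun j hj => ?_⟩
  rcases eq_or_ne j i with rfl | hji
  · exact hi
  · have := (Finset.sum_eq_zero_iff_of_nonneg h4).1 h9 j (by simp [hji])
    linarith [(mul_eq_zero.1 this).resolve_left hj.ne']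

theorem hurwitz_of_forall_pDep {n : ℕ} {A : Matrix (Fin n) (Fin n) ℝ}
    (hA : ∀ i j, 0 ≤ A i j) {γ : Fin n → ℝ} (hγ : ∀ i, 0 ≤ γ i) (hP : ∀ i, PDep A γ i) :
    Hurwitz (-(Lap A + Matrix.diagonal γ)) := by
  intro μ hμ
  by_contra! hre
  rw [spectrum.mem_iff, Matrix.isUnit_iff_isUnit_det, isUnit_iff_ne_zero, not_not,
    ← Matrix.exists_mulVec_eq_zero_iff] at hμ
  obtain ⟨v, hv0, hv⟩ := hμ
  have hev : (-(Lap A + Matrix.diagonal γ)).map (algebraMap ℝ ℂ) *ᵥ v = μ • v := by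
    rw [Matrix.sub_mulVec, sub_eq_zero, Algebra.algebraMap_eq_smul_one, Matrix.smul_mulVec,
      Matrix.one_mulVec] at hv
    exact hv.symm
  obtain ⟨k, hk⟩ := Function.ne_iff.1 hv0
  have : Nonempty (Fin n) := ⟨k⟩
  obtain ⟨i, hi⟩ := Finite.exists_max fun i => ‖v i‖
  have hm : 0 < ‖v i‖ := (norm_pos_iff.2 hk).trans_le (hi k)
  obtain ⟨j, hij, hj⟩ := hP i
  have hvj : ‖v j‖ = ‖v i‖ := by
    clear hj
    induction hij with
    | refl => rfl
    | tail _ hbc ih => exact (eq_zero_and_norm_eq_of_norm_max hA hγ hre hm hi hev ih).2 _ hbc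
  exact hj.ne' (eq_zero_and_norm_eq_of_norm_max hA hγ hre hm hi hev hvj).1

theorem forall_pDep_of_hurwitz {n : ℕ} {A : Matrix (Fin n) (Fin n) ℝ}
    (hA : ∀ i j, 0 ≤ A i j) {γ : Fin n → ℝ} (hγ : ∀ i, 0 ≤ γ i)
    (h : Hurwitz (-(Lap A + Matrix.diagonal γ))) (i : Fin n) : PDep A γ i := by
  classical
  by_contra hi
  refine lt_irrefl (0 : ℝ) (h 0 ?_)
  set N := (-(Lap A + Matrix.diagonal γ)).map (algebraMap ℝ ℂ) with hN
  have hzero : ∀ p, ¬ PDep A γ p → ∀ q, PDep A γ q → N p q = 0 := by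
    rintro p hp q ⟨j, hqj, hj⟩
    have hpq : p ≠ q := by
      rintro rfl
      exact hp ⟨j, hqj, hj⟩
    have hApq : A p q = 0 := by
      by_contra hne
      exact hp ⟨j, .head ((hA p q).lt_of_ne' hne) hqj, hj⟩
    simp [hN, Lap, hpq, hApq]
  have hdet : (N.toSquareBlockProp fun p => ¬ PDep A γ p).det = 0 := by
    rw [← Matrix.exists_mulVec_eq_zero_iff]
    refine ⟨1, fun h1 => one_ne_zero (congrFun h1 ⟨i, hi⟩), ?_⟩
    ext ⟨p, hp⟩
    have hγp : γ p = 0 := by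
      by_contra hne
      exact hp ⟨p, .refl, (hγ p).lt_of_ne' hne⟩
    have hrow := neg_lap_add_diagonal_mulVec A γ 1 p
    rw [← hN] at hrow
    simp only [Matrix.mulVec, dotProduct, Pi.one_apply, mul_one, hγp, add_zero,
      Complex.ofReal_sum, sub_self] at hrow
    rw [← Fintype.sum_subtype_add_sum_subtype (PDep A γ) (N p),
      Finset.sum_eq_zero fun (q : Subtype (PDep A γ)) _ => hzero p hp q q.2, zero_add] at hrow
    simpa [Matrix.mulVec, dotProduct, Matrix.toSquareBlockProp] using hrow
  rw [spectrum.zero_mem_iff, Matrix.isUnit_iff_isUnit_det, isUnit_iff_ne_zero, not_not,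
    Matrix.twoBlockTriangular_det N (PDep A γ) hzero, hdet, mul_zero]

theorem stmt0 {n : ℕ} (A : Matrix (Fin n) (Fin n) ℝ) (hA : ∀ i j, 0 ≤ A i j)
    (γ : Fin n → ℝ) (hγ : ∀ i, 0 ≤ γ i) :
    Hurwitz (-(Lap A + Matrix.diagonal γ)) ↔ ∀ i, PDep A γ i := by
  exact ⟨forall_pDep_of_hurwitz hA hγ, hurwitz_of_forall_pDep hA hγ⟩
end

section
/- Let A be an n×n nonnegative real matrix, L[A] its Laplacian, Γ = diag(γ₁,…,γₙ) with γᵢ ≥ 0, and suppose every agent is P-dependent. Then L[A]+Γ is invertible and, for every initial condition x(0) ∈ ℝⁿ and every constant vector u ∈ ℝⁿ, the solution of the Taylor model ẋ(t) = −(L[A]+Γ)x(t) + Γu converges as t → ∞ to the unique equilibrium (L[A]+Γ)⁻¹Γu. -/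
open Matrix Filter Topology

lemma Lap_add_diagonal_mulVec {n : ℕ} (A : Matrix (Fin n) (Fin n) ℝ) (γ v : Fin n → ℝ)
    (i : Fin n) :
    ((Lap A + Matrix.diagonal γ) *ᵥ v) i = ∑ j, A i j * (v i - v j) + γ i * v i := by
  have h : (Lap A *ᵥ v) i = ∑ j, A i j * (v i - v j) := by
    simp only [mulVec, dotProduct, Lap, Matrix.of_apply]
    rw [← Finset.add_sum_erase _ _ (Finset.mem_univ i),
      ← Finset.add_sum_erase _ (fun j => A i j * (v i - v j)) (Finset.mem_univ i)]
    have h2 : ∑ j ∈ Finset.univ.erase i,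
        (if i = j then ∑ k ∈ Finset.univ.erase i, A i k else -A i j) * v j
        = ∑ j ∈ Finset.univ.erase i, -A i j * v j :=
      Finset.sum_congr rfl fun j hj => by rw [if_neg (Finset.ne_of_mem_erase hj).symm]
    rw [h2, if_pos rfl, sub_self, mul_zero, zero_add, Finset.sum_mul, ← Finset.sum_add_distrib]
    exact Finset.sum_congr rfl fun j _ => by ring
  rw [Matrix.add_mulVec, Pi.add_apply, h, Matrix.mulVec_diagonal]

/-- Discrete minimum principle for `L[A] + Γ`. -/
lemma nonneg_of_Lap_add_diagonal_mulVec_nonneg {n : ℕ} {A : Matrix (Fin n) (Fin n) ℝ}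
    (hA : ∀ i j, 0 ≤ A i j) {γ : Fin n → ℝ} (hγ : ∀ i, 0 ≤ γ i) (hP : ∀ i, PDep A γ i)
    {v : Fin n → ℝ} (hv : ∀ i, 0 ≤ ((Lap A + Matrix.diagonal γ) *ᵥ v) i) (i : Fin n) :
    0 ≤ v i := by
  have : Nonempty (Fin n) := ⟨i⟩
  obtain ⟨m, hm⟩ := Finite.exists_min v
  by_contra! hi
  have hneg : v m < 0 := (hm i).trans_lt hi
  have key : ∀ p, v p = v m → γ p = 0 ∧ ∀ q, 0 < A p q → v q = v m := by
    intro p hp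
    have h := hv p
    rw [Lap_add_diagonal_mulVec] at h
    have hterm : ∀ j ∈ Finset.univ, A p j * (v p - v j) ≤ 0 := fun j _ =>
      mul_nonpos_of_nonneg_of_nonpos (hA p j) (by linarith [hm j])
    have hsum := Finset.sum_nonpos hterm
    have hg : γ p * v p ≤ 0 := mul_nonpos_of_nonneg_of_nonpos (hγ p) (by linarith)
    have hs0 : ∑ j, A p j * (v p - v j) = 0 := by linarith
    have hg0 : γ p * v p = 0 := by linarith
    refine ⟨(mul_eq_zero.1 hg0).resolve_right (by linarith), fun q hq => ?_⟩
    have := (Finset.sum_eq_zero_iff_of_nonpos hterm).1 hs0 q (Finset.mem_univ q)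
    have := (mul_eq_zero.1 this).resolve_left hq.ne'
    linarith
  obtain ⟨j, hj, hγj⟩ := hP m
  have hvj : v j = v m := by
    clear hγj
    induction hj with
    | refl => rfl
    | tail _ hqr ih => exact (key _ ih).2 _ hqr
  exact hγj.ne' (key j hvj).1

lemma isUnit_Lap_add_diagonal {n : ℕ} {A : Matrix (Fin n) (Fin n) ℝ}
    (hA : ∀ i j, 0 ≤ A i j) {γ : Fin n → ℝ} (hγ : ∀ i, 0 ≤ γ i) (hP : ∀ i, PDep A γ i) :
    IsUnit (Lap A + Matrix.diagonal γ) := by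
  rw [← Matrix.mulVec_injective_iff_isUnit]
  intro v w hvw
  have hle : ∀ {v w : Fin n → ℝ}, (Lap A + Matrix.diagonal γ) *ᵥ v =
      (Lap A + Matrix.diagonal γ) *ᵥ w → ∀ i, w i ≤ v i := by
    intro v w h i
    have := nonneg_of_Lap_add_diagonal_mulVec_nonneg hA hγ hP (v := v - w)
      (fun j => by rw [Matrix.mulVec_sub, h, sub_self, Pi.zero_apply]) i
    simpa using this
  exact funext fun i => le_antisymm (hle hvw.symm i) (hle hvw i)

/-- Solutions of `y' = -M y` tend to zero if `M` has nonpositive off-diagonal entries and maps some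
positive vector to a positive vector. -/
lemma tendsto_zero_of_hasDerivAt_neg_mulVec {ι : Type*} [Fintype ι]
    {M : Matrix ι ι ℝ} (hM : ∀ i j, i ≠ j → M i j ≤ 0) {w : ι → ℝ} (hw : ∀ i, 0 < w i)
    (hMw : ∀ i, 0 < (M *ᵥ w) i) {y : ℝ → ι → ℝ} (hy : ∀ t, HasDerivAt y (-(M *ᵥ y t)) t) :
    Tendsto y atTop (𝓝 0) := by
  classical
  obtain ⟨ε, hε, hεw⟩ : ∃ ε : ℝ, 0 < ε ∧ ∀ i, ε * w i ≤ (M *ᵥ w) i := by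
    have h : ∀ᶠ ε : ℝ in 𝓝[>] 0, ∀ i, ε * w i ≤ (M *ᵥ w) i := by
      refine eventually_all.2 fun i => ?_
      have ht : Tendsto (fun ε : ℝ => ε * w i) (𝓝[>] 0) (𝓝 (0 * w i)) :=
        ((continuous_id.mul continuous_const).tendsto (0 : ℝ)).mono_left nhdsWithin_le_nhds
      rw [zero_mul] at ht
      exact (ht.eventually (gt_mem_nhds (hMw i))).mono fun _ h => le_of_lt h
    obtain ⟨ε, h1, h2⟩ := (h.and self_mem_nhdsWithin).exists
    exact ⟨ε, h2, h1⟩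
  set c : ℝ := ∑ k, |M k k|
  have hcM : ∀ i, M i i ≤ c := fun i => (le_abs_self _).trans
    (Finset.single_le_sum (f := fun k => |M k k|) (fun k _ => abs_nonneg _) (Finset.mem_univ i))
  -- The matrix `c - M` is entrywise nonnegative.
  have hB : ∀ i j, 0 ≤ (Matrix.diagonal (fun _ => c) - M : Matrix ι ι ℝ) i j := by
    intro i j
    rcases eq_or_ne i j with rfl | h
    · simpa using hcM i
    · simpa [h] using hM i j h
  have hBv : ∀ (v : ι → ℝ) i, ∑ j, (Matrix.diagonal (fun _ => c) - M : Matrix ι ι ℝ) i j * v j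
      = c * v i - (M *ᵥ v) i := by
    intro v i
    have : ((Matrix.diagonal (fun _ => c) - M : Matrix ι ι ℝ) *ᵥ v) i = c * v i - (M *ᵥ v) i := by
      rw [Matrix.sub_mulVec, Pi.sub_apply, Matrix.mulVec_diagonal]
    exact this
  have hbound : ∀ (v : ι → ℝ) (K : ℝ), 0 ≤ K → (∀ j, |v j| ≤ K * w j) →
      ∀ i, |c * v i - (M *ᵥ v) i| ≤ (c - ε) * K * w i := by
    intro v K hK hv i
    rw [← hBv]
    calc _ ≤ ∑ j, |(Matrix.diagonal (fun _ => c) - M : Matrix ι ι ℝ) i j * v j| :=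
          Finset.abs_sum_le_sum_abs _ _
      _ ≤ ∑ j, K * ((Matrix.diagonal (fun _ => c) - M : Matrix ι ι ℝ) i j * w j) := by
          refine Finset.sum_le_sum fun j _ => ?_
          rw [abs_mul, abs_of_nonneg (hB i j)]
          calc _ ≤ _ := mul_le_mul_of_nonneg_left (hv j) (hB i j)
            _ = _ := by ring
      _ = K * (c * w i - (M *ᵥ w) i) := by rw [← Finset.mul_sum, hBv]
      _ ≤ K * (c * w i - ε * w i) :=
          mul_le_mul_of_nonneg_left (sub_le_sub_left (hεw i) _) hK
      _ = _ := by ring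
  set q : ℝ → ι → ℝ := fun t i => Real.exp (c * t) * y t i / w i with hq
  set q' : ℝ → ι → ℝ := fun t i =>
    Real.exp (c * t) * (c * y t i - (M *ᵥ y t) i) / w i with hq'
  have hqd : ∀ t, HasDerivAt q (q' t) t := by
    intro t
    rw [hasDerivAt_pi]
    intro i
    have h1 : HasDerivAt (fun t => Real.exp (c * t)) (Real.exp (c * t) * c) t := by
      simpa using ((hasDerivAt_id t).const_mul c).exp
    have h2 := (hasDerivAt_pi.1 (hy t)) i
    refine ((h1.mul h2).div_const (w i)).congr_deriv ?_
    simp only [hq', Pi.neg_apply]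
    ring
  have hyq : ∀ t i, |y t i| = Real.exp (-(c * t)) * |q t i| * w i := by
    intro t i
    simp only [hq]
    rw [abs_div, abs_mul, abs_of_pos (Real.exp_pos _), abs_of_pos (hw i), Real.exp_neg]
    have := (hw i).ne'
    field_simp
  rcases isEmpty_or_nonempty ι with hι | hι
  · exact tendsto_const_nhds.congr fun t => Subsingleton.elim _ _
  have hqb : ∀ t, ‖q' t‖ ≤ (c - ε) * ‖q t‖ := by
    intro t
    refine (pi_norm_le_iff_of_nonempty _).2 fun i => ?_
    have h := hbound (y t) (Real.exp (-(c * t)) * ‖q t‖) (by positivity) (fun j => by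
      rw [hyq]
      have := norm_le_pi_norm (q t) j
      rw [Real.norm_eq_abs] at this
      have := (hw j).le
      gcongr) i
    simp only [hq']
    rw [Real.norm_eq_abs, abs_div, abs_mul, abs_of_pos (Real.exp_pos _), abs_of_pos (hw i),
      div_le_iff₀ (hw i)]
    calc _ ≤ _ := mul_le_mul_of_nonneg_left h (Real.exp_pos _).le
      _ = (Real.exp (c * t) * Real.exp (-(c * t))) * ((c - ε) * ‖q t‖ * w i) := by ring
      _ = _ := by rw [← Real.exp_add, add_neg_cancel, Real.exp_zero, one_mul]
  have hgr : ∀ t, 0 ≤ t → ‖q t‖ ≤ ‖q 0‖ * Real.exp ((c - ε) * t) := by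
    intro t ht
    have := norm_le_gronwallBound_of_norm_deriv_right_le (f := q) (f' := q') (δ := ‖q 0‖)
      (K := c - ε) (ε := 0) (a := 0) (b := t)
      (fun s _ => (hqd s).continuousAt.continuousWithinAt)
      (fun s _ => (hqd s).hasDerivWithinAt) le_rfl (fun s _ => by simpa using hqb s)
      t ⟨ht, le_rfl⟩
    simpa [gronwallBound_ε0] using this
  rw [tendsto_pi_nhds]
  intro i
  have hlim : Tendsto (fun t => ‖q 0‖ * w i * Real.exp (-(ε * t))) atTop (𝓝 0) := by
    have := (Real.tendsto_exp_neg_atTop_nhds_zero.comp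
      (tendsto_id.const_mul_atTop hε)).const_mul (‖q 0‖ * w i)
    simpa using this
  refine squeeze_zero_norm' ?_ hlim
  filter_upwards [eventually_ge_atTop 0] with t ht
  rw [Real.norm_eq_abs, hyq]
  have h1 : |q t i| ≤ ‖q 0‖ * Real.exp ((c - ε) * t) := (norm_le_pi_norm (q t) i).trans (hgr t ht)
  have := (hw i).le
  calc _ ≤ Real.exp (-(c * t)) * (‖q 0‖ * Real.exp ((c - ε) * t)) * w i := by gcongr
    _ = ‖q 0‖ * w i * (Real.exp (-(c * t)) * Real.exp ((c - ε) * t)) := by ring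
    _ = _ := by rw [← Real.exp_add]; congr 2; ring

theorem stmt1 {n : ℕ} (A : Matrix (Fin n) (Fin n) ℝ) (hA : ∀ i j, 0 ≤ A i j)
    (γ : Fin n → ℝ) (hγ : ∀ i, 0 ≤ γ i) (hP : ∀ i, PDep A γ i) :
    IsUnit (Lap A + Matrix.diagonal γ) ∧
    ∀ (u : Fin n → ℝ) (x : ℝ → Fin n → ℝ),
      (∀ t, HasDerivAt x
        ((-(Lap A + Matrix.diagonal γ)) *ᵥ x t + Matrix.diagonal γ *ᵥ u) t) →
      Tendsto x atTop (𝓝 ((Lap A + Matrix.diagonal γ)⁻¹ *ᵥ (Matrix.diagonal γ *ᵥ u))) := by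
  have hU := isUnit_Lap_add_diagonal hA hγ hP
  refine ⟨hU, fun u x hx => ?_⟩
  have hinv : ∀ b : Fin n → ℝ, (Lap A + Matrix.diagonal γ) *ᵥ
      ((Lap A + Matrix.diagonal γ)⁻¹ *ᵥ b) = b := fun b => by
    rw [Matrix.mulVec_mulVec, Matrix.mul_nonsing_inv _ ((Matrix.isUnit_iff_isUnit_det _).1 hU),
      Matrix.one_mulVec]
  set e := (Lap A + Matrix.diagonal γ)⁻¹ *ᵥ (Matrix.diagonal γ *ᵥ u) with he
  set w := (Lap A + Matrix.diagonal γ)⁻¹ *ᵥ (1 : Fin n → ℝ) with hw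
  have hMw : ∀ i, 0 < ((Lap A + Matrix.diagonal γ) *ᵥ w) i := fun i => by
    rw [hw, hinv]; exact one_pos
  have hw0 := nonneg_of_Lap_add_diagonal_mulVec_nonneg hA hγ hP fun i => (hMw i).le
  have hwpos : ∀ i, 0 < w i := by
    refine fun i => (hw0 i).lt_of_ne fun h => ?_
    have h1 := hMw i
    rw [Lap_add_diagonal_mulVec, ← h, mul_zero, add_zero] at h1
    refine h1.not_ge (Finset.sum_nonpos fun j _ => ?_)
    exact mul_nonpos_of_nonneg_of_nonpos (hA i j) (by linarith [hw0 j])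
  have hoff : ∀ i j, i ≠ j → (Lap A + Matrix.diagonal γ) i j ≤ 0 := fun i j h => by
    simpa [Lap, h] using hA i j
  have hlim := tendsto_zero_of_hasDerivAt_neg_mulVec hoff hwpos hMw (y := fun t => x t - e)
    (fun t => ((hx t).sub_const e).congr_deriv (by
      rw [Matrix.mulVec_sub, he, hinv, Matrix.neg_mulVec]; abel))
  simpa using hlim.add_const e
end

section
/- Consider the scalar Taylor model ẋᵢ(t) = Σⱼ aᵢⱼ(xⱼ(t) − xᵢ(t)) + Σ_{m=1}^{k} b_{im}(s_m − xᵢ(t)) with nonnegative n×n matrix A = (aᵢⱼ), nonnegative n×k matrix B = (b_{im}) and static source opinions s₁,…,s_k ∈ ℝ. If every agent is P-dependent (with γᵢ := Σ_m b_{im}), then for every initial condition the limits xᵢ(∞) = lim_{t→∞} xᵢ(t) exist and satisfy min_m s_m ≤ xᵢ(∞) ≤ max_m s_m for every agent i. -/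
open Matrix Filter Topology

/-- The operator `w ↦ (γ + L) w`, with `L` the Laplacian of the weighted digraph `A`. -/
def groundedLaplacian {n : ℕ} (A : Matrix (Fin n) (Fin n) ℝ) (γ : Fin n → ℝ) :
    (Fin n → ℝ) →ₗ[ℝ] (Fin n → ℝ) where
  toFun w i := γ i * w i - ∑ j, A i j * (w j - w i)
  map_add' v w := by
    ext i
    simp only [Pi.add_apply]
    have : ∀ j, A i j * (v j + w j - (v i + w i))
        = A i j * (v j - v i) + A i j * (w j - w i) := fun j => by ring
    simp only [this, Finset.sum_add_distrib]
    ring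
  map_smul' r w := by
    ext i
    simp only [Pi.smul_apply, smul_eq_mul, RingHom.id_apply]
    have : ∀ j, A i j * (r * w j - r * w i) = r * (A i j * (w j - w i)) := fun j => by ring
    simp only [this, ← Finset.mul_sum]
    ring

theorem groundedLaplacian_apply {n : ℕ} (A : Matrix (Fin n) (Fin n) ℝ) (γ w : Fin n → ℝ)
    (i : Fin n) : groundedLaplacian A γ w i = γ i * w i - ∑ j, A i j * (w j - w i) := rfl

/-- Minimum principle for the grounded Laplacian. -/
theorem nonneg_of_groundedLaplacian_nonneg {n : ℕ} {A : Matrix (Fin n) (Fin n) ℝ}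
    {γ : Fin n → ℝ} (hA : ∀ i j, 0 ≤ A i j) (hγ : ∀ i, 0 ≤ γ i) (hP : ∀ i, PDep A γ i)
    {w : Fin n → ℝ} (hw : ∀ i, 0 ≤ groundedLaplacian A γ w i) (i : Fin n) : 0 ≤ w i := by
  have : Nonempty (Fin n) := ⟨i⟩
  obtain ⟨i₀, hmin⟩ := Finite.exists_min w
  by_contra! hi
  have hneg : w i₀ < 0 := (hmin i).trans_lt hi
  have key : ∀ p, w p = w i₀ → γ p = 0 ∧ ∀ q, 0 < A p q → w q = w i₀ := by
    intro p hp
    have hterm : ∀ j ∈ Finset.univ, 0 ≤ A p j * (w j - w p) := fun j _ =>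
      mul_nonneg (hA p j) (by linarith [hmin j])
    have hsum := Finset.sum_nonneg hterm
    have h := hw p
    rw [groundedLaplacian_apply] at h
    have hle : γ p * w p ≤ 0 := mul_nonpos_of_nonneg_of_nonpos (hγ p) (by linarith)
    have hγw : γ p * w p = 0 := by linarith
    have hs : ∑ j, A p j * (w j - w p) = 0 := by linarith
    refine ⟨(mul_eq_zero.mp hγw).resolve_right (by linarith), fun q hq => ?_⟩
    have := (mul_eq_zero.mp ((Finset.sum_eq_zero_iff_of_nonneg hterm).mp hs q
      (Finset.mem_univ q))).resolve_left hq.ne'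
    linarith
  obtain ⟨j, hpath, hj⟩ := hP i₀
  have hwj : w j = w i₀ := by
    clear hj
    induction hpath with
    | refl => rfl
    | tail _ hbc ih => exact (key _ ih).2 _ hbc
  exact hj.ne' (key j hwj).1

theorem groundedLaplacian_surjective {n : ℕ} {A : Matrix (Fin n) (Fin n) ℝ}
    {γ : Fin n → ℝ} (hA : ∀ i j, 0 ≤ A i j) (hγ : ∀ i, 0 ≤ γ i) (hP : ∀ i, PDep A γ i) :
    Function.Surjective (groundedLaplacian A γ) := by
  refine LinearMap.injective_iff_surjective.mp
    ((injective_iff_map_eq_zero (groundedLaplacian A γ)).mpr fun w hw => funext fun i => ?_)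
  have h₁ := nonneg_of_groundedLaplacian_nonneg hA hγ hP (w := w) (by simp [hw]) i
  have h₂ := nonneg_of_groundedLaplacian_nonneg hA hγ hP (w := -w) (by simp [hw]) i
  simp only [Pi.neg_apply] at h₂
  simp only [Pi.zero_apply]
  linarith

theorem exists_pos_groundedLaplacian_eq_one {n : ℕ} {A : Matrix (Fin n) (Fin n) ℝ}
    {γ : Fin n → ℝ} (hA : ∀ i j, 0 ≤ A i j) (hγ : ∀ i, 0 ≤ γ i) (hP : ∀ i, PDep A γ i) :
    ∃ w : Fin n → ℝ, (∀ i, 0 < w i) ∧ groundedLaplacian A γ w = 1 := by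
  obtain ⟨w, hw⟩ := groundedLaplacian_surjective hA hγ hP 1
  have hnn := nonneg_of_groundedLaplacian_nonneg hA hγ hP (w := w) (by simp [hw])
  refine ⟨w, fun i => (hnn i).lt_of_ne' fun hi => ?_, hw⟩
  have h := congrFun hw i
  simp only [groundedLaplacian_apply, hi, mul_zero, sub_zero, zero_sub, Pi.one_apply] at h
  have := Finset.sum_nonneg fun j (_ : j ∈ Finset.univ) => mul_nonneg (hA i j) (hnn j)
  linarith

/-- In the sup norm weighted by `w`, the operator `c - groundedLaplacian A γ` has norm at most
`c - δ`. -/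
theorem abs_sub_groundedLaplacian_le {n : ℕ} {A : Matrix (Fin n) (Fin n) ℝ}
    {γ : Fin n → ℝ} (hA : ∀ i j, 0 ≤ A i j) {w : Fin n → ℝ} (hpos : ∀ i, 0 < w i) {c δ : ℝ}
    (i : Fin n) (hc : ∑ j, A i j + γ i ≤ c) (hδ : δ * w i ≤ groundedLaplacian A γ w i)
    (z : Fin n → ℝ) :
    |c * (w i * z i) - groundedLaplacian A γ (fun j => w j * z j) i| ≤ (c - δ) * ‖z‖ * w i := by
  have expand : ∀ v : Fin n → ℝ, c * v i - groundedLaplacian A γ v i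
      = (c - (∑ j, A i j + γ i)) * v i + ∑ j, A i j * v j := fun v => by
    simp only [groundedLaplacian_apply, mul_sub, Finset.sum_sub_distrib, ← Finset.sum_mul]
    ring
  have hz : ∀ j, |w j * z j| ≤ w j * ‖z‖ := fun j => by
    rw [abs_mul, abs_of_pos (hpos j)]
    exact mul_le_mul_of_nonneg_left (norm_le_pi_norm z j) (hpos j).le
  have hc' : 0 ≤ c - (∑ j, A i j + γ i) := by linarith
  calc |c * (w i * z i) - groundedLaplacian A γ (fun j => w j * z j) i|
      = |(c - (∑ j, A i j + γ i)) * (w i * z i) + ∑ j, A i j * (w j * z j)| := by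
        rw [← expand fun j => w j * z j]
    _ ≤ |(c - (∑ j, A i j + γ i)) * (w i * z i)| + ∑ j, |A i j * (w j * z j)| :=
        (abs_add_le _ _).trans (add_le_add le_rfl (Finset.abs_sum_le_sum_abs _ _))
    _ ≤ (c - (∑ j, A i j + γ i)) * (w i * ‖z‖) + ∑ j, A i j * (w j * ‖z‖) := by
        refine add_le_add ?_ (Finset.sum_le_sum fun j _ => ?_)
        · rw [abs_mul, abs_of_nonneg hc']
          exact mul_le_mul_of_nonneg_left (hz i) hc'
        · rw [abs_mul, abs_of_nonneg (hA i j)]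
          exact mul_le_mul_of_nonneg_left (hz j) (hA i j)
    _ = (c * w i - groundedLaplacian A γ w i) * ‖z‖ := by
        rw [expand w, add_mul, Finset.sum_mul]
        simp only [mul_assoc]
    _ ≤ (c * w i - δ * w i) * ‖z‖ :=
        mul_le_mul_of_nonneg_right (by linarith) (norm_nonneg z)
    _ = (c - δ) * ‖z‖ * w i := by ring

theorem tendsto_zero_of_hasDerivAt_neg_groundedLaplacian {n : ℕ} {A : Matrix (Fin n) (Fin n) ℝ}
    {γ : Fin n → ℝ} (hA : ∀ i j, 0 ≤ A i j) (hγ : ∀ i, 0 ≤ γ i) (hP : ∀ i, PDep A γ i)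
    {y : ℝ → Fin n → ℝ} (hy : ∀ t, HasDerivAt y (-groundedLaplacian A γ (y t)) t) :
    Tendsto y atTop (𝓝 0) := by
  obtain ⟨w, hpos, hw⟩ := exists_pos_groundedLaplacian_eq_one hA hγ hP
  have hW : 0 < ∑ j, w j + 1 := by
    linarith [Finset.sum_nonneg fun j (_ : j ∈ Finset.univ) => (hpos j).le]
  set δ : ℝ := (∑ j, w j + 1)⁻¹ with hδdef
  have hδ : 0 < δ := inv_pos.mpr hW
  have hδw : ∀ i, δ * w i ≤ groundedLaplacian A γ w i := fun i => by
    rw [hw, Pi.one_apply, hδdef, inv_mul_le_one₀ hW]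
    linarith [Finset.single_le_sum (fun j _ => (hpos j).le) (Finset.mem_univ i)]
  obtain ⟨c, hcδ, hc⟩ : ∃ c, δ ≤ c ∧ ∀ i, ∑ j, A i j + γ i ≤ c := by
    have hnn : ∀ i ∈ Finset.univ, 0 ≤ ∑ j, A i j + γ i := fun i _ =>
      add_nonneg (Finset.sum_nonneg fun j _ => hA i j) (hγ i)
    refine ⟨δ + ∑ i, (∑ j, A i j + γ i), by linarith [Finset.sum_nonneg hnn], fun i => ?_⟩
    linarith [Finset.single_le_sum hnn (Finset.mem_univ i)]
  set z : ℝ → Fin n → ℝ := fun t i => Real.exp (c * t) * y t i / w i with hz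
  have hwz : ∀ t i, w i * z t i = Real.exp (c * t) * y t i := fun t i => by
    rw [hz]; field_simp [(hpos i).ne']
  have hz' : ∀ t, HasDerivAt z (fun i =>
      (c * (w i * z t i) - groundedLaplacian A γ (fun j => w j * z t j) i) / w i) t := by
    intro t
    refine hasDerivAt_pi.mpr fun i => ?_
    have hexp : HasDerivAt (fun t => Real.exp (c * t)) (Real.exp (c * t) * c) t := by
      simpa using ((hasDerivAt_id t).const_mul c).exp
    refine ((hexp.mul (hasDerivAt_pi.mp (hy t) i)).div_const (w i)).congr_deriv ?_
    have : (fun j => w j * z t j) = Real.exp (c * t) • y t := funext fun j => hwz t j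
    rw [this, hwz, map_smul]
    simp only [Pi.smul_apply, Pi.neg_apply, smul_eq_mul]
    ring
  have hbound : ∀ t, 0 ≤ t → ‖z t‖ ≤ ‖z 0‖ * Real.exp ((c - δ) * t) := by
    intro t ht
    have := norm_le_gronwallBound_of_norm_deriv_right_le (f := z) (δ := ‖z 0‖) (K := c - δ)
      (ε := 0) (a := 0) (b := t) (fun s _ => (hz' s).continuousAt.continuousWithinAt)
      (fun s _ => (hz' s).hasDerivWithinAt) le_rfl (fun s _ => ?_) t ⟨ht, le_rfl⟩
    · simpa [gronwallBound_ε0] using this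
    · rw [add_zero]
      refine (pi_norm_le_iff_of_nonneg
        (mul_nonneg (by linarith) (norm_nonneg _))).mpr fun i => ?_
      rw [Real.norm_eq_abs, abs_div, abs_of_pos (hpos i), div_le_iff₀ (hpos i)]
      exact abs_sub_groundedLaplacian_le hA hpos i (hc i) (hδw i) (z s)
  refine tendsto_pi_nhds.mpr fun i => ?_
  have hlim : Tendsto (fun t => w i * ‖z 0‖ * Real.exp (-(δ * t))) atTop (𝓝 0) := by
    simpa using (Real.tendsto_exp_neg_atTop_nhds_zero.comp
      (tendsto_id.const_mul_atTop hδ)).const_mul (w i * ‖z 0‖)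
  refine squeeze_zero_norm' ?_ hlim
  filter_upwards [eventually_ge_atTop 0] with t ht
  have hyz : y t i = Real.exp (-(c * t)) * (w i * z t i) := by
    rw [hwz, ← mul_assoc, ← Real.exp_add]
    simp
  calc ‖y t i‖ = Real.exp (-(c * t)) * (w i * |z t i|) := by
        rw [hyz, Real.norm_eq_abs, abs_mul, abs_mul, Real.abs_exp, abs_of_pos (hpos i)]
    _ ≤ Real.exp (-(c * t)) * (w i * (‖z 0‖ * Real.exp ((c - δ) * t))) := by
        gcongr
        · exact (hpos i).le
        · exact (norm_le_pi_norm (z t) i).trans (hbound t ht)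
    _ = w i * ‖z 0‖ * Real.exp (-(δ * t)) := by
        have : -(δ * t) = -(c * t) + (c - δ) * t := by ring
        rw [this, Real.exp_add]
        ring

theorem stmt3 {n k : ℕ} (hne : (Finset.univ : Finset (Fin k)).Nonempty)
    (A : Matrix (Fin n) (Fin n) ℝ) (hA : ∀ i j, 0 ≤ A i j)
    (B : Matrix (Fin n) (Fin k) ℝ) (hB : ∀ i m, 0 ≤ B i m)
    (s : Fin k → ℝ)
    (hP : ∀ i, PDep A (fun i => ∑ m, B i m) i)
    (x : ℝ → Fin n → ℝ)
    (hx : ∀ t, HasDerivAt x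
      (fun i => (∑ j, A i j * (x t j - x t i)) + ∑ m, B i m * (s m - x t i)) t) :
    ∃ xinf : Fin n → ℝ, Tendsto x atTop (𝓝 xinf) ∧
      ∀ i, Finset.univ.inf' hne s ≤ xinf i ∧ xinf i ≤ Finset.univ.sup' hne s := by
  have hγ : ∀ i, 0 ≤ ∑ m, B i m := fun i => Finset.sum_nonneg fun m _ => hB i m
  obtain ⟨e, he⟩ := groundedLaplacian_surjective hA hγ hP (fun i => ∑ m, B i m * s m)
  have hconst : ∀ (r : ℝ) (i : Fin n),
      groundedLaplacian A (fun i => ∑ m, B i m) (fun _ => r) i = ∑ m, B i m * r := fun r i => by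
    simp [groundedLaplacian_apply, Finset.sum_mul]
  refine ⟨e, ?_, fun i => ⟨?_, ?_⟩⟩
  · have hy : ∀ t, HasDerivAt (fun t => x t - e)
        (-groundedLaplacian A (fun i => ∑ m, B i m) (x t - e)) t := by
      intro t
      refine ((hx t).sub_const e).congr_deriv ?_
      rw [map_sub, he]
      ext i
      simp only [Pi.neg_apply, Pi.sub_apply, groundedLaplacian_apply, mul_sub,
        Finset.sum_sub_distrib, Finset.sum_mul]
      ring
    simpa using (tendsto_zero_of_hasDerivAt_neg_groundedLaplacian hA hγ hP hy).add_const e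
  · have := nonneg_of_groundedLaplacian_nonneg hA hγ hP
      (w := e - fun _ => Finset.univ.inf' hne s) (fun i => ?_) i
    · simpa using this
    · rw [map_sub, Pi.sub_apply, hconst, he, sub_nonneg]
      exact Finset.sum_le_sum fun m hm =>
        mul_le_mul_of_nonneg_left (Finset.inf'_le s hm) (hB i m)
  · have := nonneg_of_groundedLaplacian_nonneg hA hγ hP
      (w := (fun _ => Finset.univ.sup' hne s) - e) (fun i => ?_) i
    · simpa using this
    · rw [map_sub, Pi.sub_apply, hconst, he, sub_nonneg]
      exact Finset.sum_le_sum fun m hm =>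
        mul_le_mul_of_nonneg_left (Finset.le_sup' s hm) (hB i m)
end

section
/- Let W be an n×n stochastic matrix, Λ = diag(λ₁,…,λₙ) with 0 ≤ λᵢ ≤ 1, and suppose every agent is P-dependent. Then I − ΛW is invertible and, for every initial condition x(0) ∈ ℝⁿ and every prejudice vector u ∈ ℝⁿ, the Friedkin-Johnsen iteration x(k+1) = ΛWx(k) + (I−Λ)u converges as k → ∞ to (I − ΛW)⁻¹(I−Λ)u. -/
open Matrix Filter Topology

/-- Agent `i` is P-dependent in the Friedkin-Johnsen model. -/
def PDepFJ {n : ℕ} (W : Matrix (Fin n) (Fin n) ℝ) (lam : Fin n → ℝ) (i : Fin n) : Prop :=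
  ∃ j, Relation.ReflTransGen (fun p q => 0 < W p q) i j ∧ lam j < 1

/-- Maximum principle: if every agent is P-dependent, a vector dominated by its image under `ΛW`
is nonpositive. -/
theorem PDepFJ.nonpos_of_le_mulVec {n : ℕ} {W : Matrix (Fin n) (Fin n) ℝ}
    (hW0 : ∀ i j, 0 ≤ W i j) (hW1 : ∀ i, ∑ j, W i j = 1)
    {lam : Fin n → ℝ} (hlam : ∀ i, 0 ≤ lam i ∧ lam i ≤ 1) (hP : ∀ i, PDepFJ W lam i)
    {s : Fin n → ℝ} (hs : s ≤ (diagonal lam * W) *ᵥ s) : s ≤ 0 := by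
  intro i
  have : Nonempty (Fin n) := ⟨i⟩
  obtain ⟨m, hm⟩ := Finite.exists_max s
  refine (hm i).trans ?_
  by_contra! hpos
  simp only [Pi.zero_apply] at hpos
  have hrow : ∀ p, s p ≤ lam p * ∑ q, W p q * s q := fun p => by
    simpa [mulVec, dotProduct, Finset.mul_sum, mul_assoc] using hs p
  have havg : ∀ p, ∑ q, W p q * s q ≤ s m := fun p => by
    calc ∑ q, W p q * s q ≤ ∑ q, W p q * s m :=
          Finset.sum_le_sum fun q _ => mul_le_mul_of_nonneg_left (hm q) (hW0 p q)
      _ = s m := by rw [← Finset.sum_mul, hW1, one_mul]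
  have hstep : ∀ p q, s p = s m → 0 < W p q → s q = s m := fun p q hp hpq => by
    have hsum : s m ≤ ∑ q, W p q * s q := by
      have h := hrow p
      rw [hp] at h
      have hnn : 0 ≤ ∑ q, W p q * s q := (pos_of_mul_pos_right (hpos.trans_le h) (hlam p).1).le
      exact h.trans (mul_le_of_le_one_left hnn (hlam p).2)
    have hgap : ∑ q, W p q * (s m - s q) = 0 := by
      simp only [mul_sub, Finset.sum_sub_distrib]
      rw [← Finset.sum_mul, hW1, one_mul, le_antisymm (havg p) hsum, sub_self]
    have h0 := (Finset.sum_eq_zero_iff_of_nonneg fun q _ =>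
      mul_nonneg (hW0 p q) (sub_nonneg.2 (hm q))).1 hgap q (Finset.mem_univ q)
    linarith [(mul_eq_zero.1 h0).resolve_left hpq.ne']
  obtain ⟨j, hj, hj1⟩ := hP m
  have hmax : s j = s m := by
    clear hj1
    induction hj with
    | refl => rfl
    | tail _ hpq ih => exact hstep _ _ ih hpq
  have h := hrow j
  rw [hmax] at h
  nlinarith [mul_le_mul_of_nonneg_left (havg j) (hlam j).1]

/-- Powers of a nonnegative substochastic matrix satisfying the maximum principle tend to zero
pointwise. -/
theorem Matrix.tendsto_pow_mulVec_zero {ι : Type*} [Fintype ι] [DecidableEq ι]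
    {A : Matrix ι ι ℝ} (hA0 : ∀ i j, 0 ≤ A i j) (hA1 : A *ᵥ 1 ≤ 1)
    (hA : ∀ s : ι → ℝ, s ≤ A *ᵥ s → s ≤ 0) (v : ι → ℝ) :
    Tendsto (fun k : ℕ => (A ^ k) *ᵥ v) atTop (𝓝 0) := by
  have hmono : ∀ x y : ι → ℝ, x ≤ y → A *ᵥ x ≤ A *ᵥ y := fun x y h i =>
    Finset.sum_le_sum fun j _ => mul_le_mul_of_nonneg_left (h j) (hA0 i j)
  have hsucc : ∀ (k : ℕ) (x : ι → ℝ), (A ^ (k + 1)) *ᵥ x = A *ᵥ ((A ^ k) *ᵥ x) := fun k x => by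
    rw [pow_succ', mulVec_mulVec]
  have hnonneg : ∀ k : ℕ, 0 ≤ (A ^ k) *ᵥ (1 : ι → ℝ) := fun k => by
    induction k with
    | zero => simp
    | succ k ih => simpa [hsucc] using hmono _ _ ih
  have hanti : Antitone fun k : ℕ => (A ^ k) *ᵥ (1 : ι → ℝ) := antitone_nat_of_succ_le fun k => by
    induction k with
    | zero => simpa using hA1
    | succ k ih => simpa [hsucc] using hmono _ _ ih
  have hlim : ∃ s, Tendsto (fun k : ℕ => (A ^ k) *ᵥ (1 : ι → ℝ)) atTop (𝓝 s) :=
    ⟨_, tendsto_atTop_ciInf hanti ⟨0, Set.forall_mem_range.2 hnonneg⟩⟩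
  obtain ⟨s, hs⟩ := hlim
  have hfix : s = A *ᵥ s := by
    refine tendsto_nhds_unique (hs.comp (tendsto_add_atTop_nat 1)) ?_
    have hcont : Continuous fun x : ι → ℝ => A *ᵥ x := continuous_const.matrix_mulVec continuous_id
    simpa only [Function.comp_def, hsucc] using (hcont.tendsto s).comp hs
  have hs0 : s = 0 := le_antisymm (hA s hfix.le) (ge_of_tendsto' hs hnonneg)
  rw [hs0] at hs
  have hbound : ∀ (k : ℕ) i, |((A ^ k) *ᵥ v) i| ≤ ‖v‖ * ((A ^ k) *ᵥ (1 : ι → ℝ)) i := fun k => by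
    induction k with
    | zero => intro i; simpa using norm_le_pi_norm v i
    | succ k ih =>
      intro i
      simp only [hsucc]
      calc |∑ j, A i j * ((A ^ k) *ᵥ v) j| ≤ ∑ j, |A i j * ((A ^ k) *ᵥ v) j| :=
            Finset.abs_sum_le_sum_abs _ _
        _ ≤ ∑ j, A i j * (‖v‖ * ((A ^ k) *ᵥ (1 : ι → ℝ)) j) :=
            Finset.sum_le_sum fun j _ => by
              rw [abs_mul, abs_of_nonneg (hA0 i j)]
              exact mul_le_mul_of_nonneg_left (ih j) (hA0 i j)
        _ = ‖v‖ * ∑ j, A i j * ((A ^ k) *ᵥ (1 : ι → ℝ)) j := by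
            rw [Finset.mul_sum]
            exact Finset.sum_congr rfl fun j _ => mul_left_comm _ _ _
  refine tendsto_pi_nhds.2 fun i => squeeze_zero_norm (fun k => hbound k i) ?_
  simpa using (tendsto_pi_nhds.1 hs i).const_mul ‖v‖

/-- If the powers of `A` tend to zero pointwise, then `1 - A` is invertible. -/
theorem Matrix.isUnit_one_sub_of_tendsto_pow_mulVec {ι : Type*} [Fintype ι] [DecidableEq ι]
    {A : Matrix ι ι ℝ} (hA : ∀ v, Tendsto (fun k : ℕ => (A ^ k) *ᵥ v) atTop (𝓝 0)) :
    IsUnit (1 - A) := by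
  rw [← mulVec_injective_iff_isUnit]
  refine (injective_iff_map_eq_zero (1 - A).mulVecLin).2 fun v hv => ?_
  have hfix : A *ᵥ v = v := by
    simpa [sub_mulVec, sub_eq_zero, eq_comm] using hv
  have hpow : ∀ k : ℕ, (A ^ k) *ᵥ v = v := fun k => by
    induction k with
    | zero => simp
    | succ k ih => rw [pow_succ, ← mulVec_mulVec, hfix, ih]
  have h := hA v
  simp only [hpow] at h
  exact tendsto_nhds_unique tendsto_const_nhds h

/-- If the powers of `A` tend to zero pointwise, then every affine iteration with linear part `A`
converges to its fixed point. -/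
theorem Matrix.tendsto_affine_iteration {ι : Type*} [Fintype ι] [DecidableEq ι]
    {A : Matrix ι ι ℝ} (hA : ∀ v, Tendsto (fun k : ℕ => (A ^ k) *ᵥ v) atTop (𝓝 0))
    {b : ι → ℝ} {x : ℕ → ι → ℝ} (hx : ∀ k, x (k + 1) = A *ᵥ x k + b) :
    Tendsto x atTop (𝓝 ((1 - A)⁻¹ *ᵥ b)) := by
  set y := (1 - A)⁻¹ *ᵥ b with hy
  have hfix : y - A *ᵥ y = b := by
    have hdet := (isUnit_iff_isUnit_det _).1 (isUnit_one_sub_of_tendsto_pow_mulVec hA)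
    have h : (1 - A) *ᵥ y = b := by rw [hy, mulVec_mulVec, mul_nonsing_inv _ hdet, one_mulVec]
    simpa [sub_mulVec] using h
  have hdiff : ∀ k, x k = (A ^ k) *ᵥ (x 0 - y) + y := fun k => by
    induction k with
    | zero => simp
    | succ k ih =>
      rw [hx, ih, pow_succ', ← mulVec_mulVec, mulVec_add, ← hfix]
      abel
  rw [funext hdiff]
  simpa using (hA (x 0 - y)).add_const y

theorem stmt8 {n : ℕ} (W : Matrix (Fin n) (Fin n) ℝ)
    (hW0 : ∀ i j, 0 ≤ W i j) (hW1 : ∀ i, ∑ j, W i j = 1)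
    (lam : Fin n → ℝ) (hlam : ∀ i, 0 ≤ lam i ∧ lam i ≤ 1)
    (hP : ∀ i, PDepFJ W lam i) :
    IsUnit (1 - Matrix.diagonal lam * W) ∧
    ∀ (u : Fin n → ℝ) (x : ℕ → Fin n → ℝ),
      (∀ k, x (k + 1) =
        (Matrix.diagonal lam * W) *ᵥ x k + (1 - Matrix.diagonal lam) *ᵥ u) →
      Tendsto x atTop
        (𝓝 ((1 - Matrix.diagonal lam * W)⁻¹ *ᵥ ((1 - Matrix.diagonal lam) *ᵥ u))) := by
  have hA0 : ∀ i j, 0 ≤ (diagonal lam * W) i j := fun i j => by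
    rw [diagonal_mul]
    exact mul_nonneg (hlam i).1 (hW0 i j)
  have hA1 : (diagonal lam * W) *ᵥ 1 ≤ 1 := fun i => by
    simpa [mulVec, dotProduct, ← Finset.mul_sum, hW1] using (hlam i).2
  have hA := tendsto_pow_mulVec_zero hA0 hA1 fun _ =>
    PDepFJ.nonpos_of_le_mulVec hW0 hW1 hlam hP
  exact ⟨isUnit_one_sub_of_tendsto_pow_mulVec hA, fun _ _ hx => tendsto_affine_iteration hA hx⟩
end

section
/- Let W be an n×n stochastic matrix, Λ = diag(λ₁,…,λₙ) with 0 ≤ λᵢ ≤ 1, and suppose every agent is P-dependent. Then the matrix V = (I − ΛW)⁻¹(I−Λ) is stochastic: all its entries are nonnegative and each of its rows sums to 1. -/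
open Matrix

lemma one_sub_diagonal_mul_mulVec {n : ℕ} (W : Matrix (Fin n) (Fin n) ℝ) (lam x : Fin n → ℝ)
    (i : Fin n) :
    ((1 - Matrix.diagonal lam * W) *ᵥ x) i = x i - lam i * ∑ j, W i j * x j := by
  rw [Matrix.sub_mulVec, Matrix.one_mulVec, ← Matrix.mulVec_mulVec, Pi.sub_apply,
    Matrix.mulVec_diagonal]
  rfl

/-- At a point where a supersolution attains a negative minimum `m`, the weight is `1` and the
value `m` propagates to all out-neighbours. -/
lemma eq_of_negative_minimum {n : ℕ} {W : Matrix (Fin n) (Fin n) ℝ}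
    (hW0 : ∀ i j, 0 ≤ W i j) (hW1 : ∀ i, ∑ j, W i j = 1)
    {lam : Fin n → ℝ} (hlam : ∀ i, 0 ≤ lam i ∧ lam i ≤ 1) {x : Fin n → ℝ} {m : ℝ}
    (hm : m < 0) (hmin : ∀ i, m ≤ x i) {p : Fin n} (hp : x p = m)
    (hx : 0 ≤ x p - lam p * ∑ j, W p j * x j) :
    lam p = 1 ∧ ∀ q, 0 < W p q → x q = m := by
  have hnn : ∀ j ∈ Finset.univ, 0 ≤ W p j * (x j - m) := fun j _ =>
    mul_nonneg (hW0 p j) (sub_nonneg.2 (hmin j))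
  have hsum : ∑ j, W p j * (x j - m) = ∑ j, W p j * x j - m := by
    simp only [mul_sub, Finset.sum_sub_distrib, ← Finset.sum_mul, hW1, one_mul]
  have hge : 0 ≤ ∑ j, W p j * x j - m := hsum ▸ Finset.sum_nonneg hnn
  obtain ⟨h0, h1⟩ := hlam p
  rw [hp] at hx
  set s := ∑ j, W p j * x j
  have hl : lam p = 1 := by
    by_contra hne
    have : lam p < 1 := lt_of_le_of_ne h1 hne
    nlinarith [mul_nonneg h0 hge, mul_pos_of_neg_of_neg hm (sub_neg.2 this)]
  refine ⟨hl, fun q hq => ?_⟩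
  have hz : ∑ j, W p j * (x j - m) = 0 := by
    rw [hsum]; rw [hl] at hx; linarith
  have := (Finset.sum_eq_zero_iff_of_nonneg hnn).1 hz q (Finset.mem_univ q)
  rcases mul_eq_zero.1 this with h | h <;> linarith

/-- Minimum principle for `1 - ΛW` when every agent is P-dependent. -/
lemma nonneg_of_mulVec_nonneg {n : ℕ} {W : Matrix (Fin n) (Fin n) ℝ}
    (hW0 : ∀ i j, 0 ≤ W i j) (hW1 : ∀ i, ∑ j, W i j = 1)
    {lam : Fin n → ℝ} (hlam : ∀ i, 0 ≤ lam i ∧ lam i ≤ 1)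
    (hP : ∀ i, PDepFJ W lam i) {x : Fin n → ℝ}
    (hx : ∀ i, 0 ≤ ((1 - Matrix.diagonal lam * W) *ᵥ x) i) (i : Fin n) : 0 ≤ x i := by
  have : Nonempty (Fin n) := ⟨i⟩
  obtain ⟨k, hk⟩ := Finite.exists_min x
  by_contra! hi
  have hm : x k < 0 := (hk i).trans_lt hi
  have key : ∀ p, x p = x k → lam p = 1 ∧ ∀ q, 0 < W p q → x q = x k := fun p hp =>
    eq_of_negative_minimum hW0 hW1 hlam hm hk hp (one_sub_diagonal_mul_mulVec W lam x p ▸ hx p)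
  obtain ⟨j, hj, hlt⟩ := hP k
  have hxj : x j = x k := by
    clear hlt
    induction hj with
    | refl => rfl
    | tail _ h ih => exact (key _ ih).2 _ h
  exact hlt.ne (key j hxj).1

lemma isUnit_one_sub_diagonal_mul {n : ℕ} {W : Matrix (Fin n) (Fin n) ℝ}
    (hW0 : ∀ i j, 0 ≤ W i j) (hW1 : ∀ i, ∑ j, W i j = 1)
    {lam : Fin n → ℝ} (hlam : ∀ i, 0 ≤ lam i ∧ lam i ≤ 1)
    (hP : ∀ i, PDepFJ W lam i) : IsUnit (1 - Matrix.diagonal lam * W) := by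
  rw [← Matrix.mulVec_injective_iff_isUnit]
  intro x y hxy
  have hle : ∀ u v : Fin n → ℝ, (1 - Matrix.diagonal lam * W) *ᵥ u =
      (1 - Matrix.diagonal lam * W) *ᵥ v → ∀ i, v i ≤ u i := fun u v h i =>
    sub_nonneg.1 <| nonneg_of_mulVec_nonneg hW0 hW1 hlam hP (x := u - v)
      (fun i => by rw [Matrix.mulVec_sub, h, sub_self, Pi.zero_apply]) i
  exact funext fun i => le_antisymm (hle y x hxy.symm i) (hle x y hxy i)

theorem stmt9 {n : ℕ} (W : Matrix (Fin n) (Fin n) ℝ)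
    (hW0 : ∀ i j, 0 ≤ W i j) (hW1 : ∀ i, ∑ j, W i j = 1)
    (lam : Fin n → ℝ) (hlam : ∀ i, 0 ≤ lam i ∧ lam i ≤ 1)
    (hP : ∀ i, PDepFJ W lam i) :
    (∀ i j, 0 ≤ ((1 - Matrix.diagonal lam * W)⁻¹ * (1 - Matrix.diagonal lam)) i j) ∧
    (∀ i, ∑ j, ((1 - Matrix.diagonal lam * W)⁻¹ * (1 - Matrix.diagonal lam)) i j = 1) := by
  have hu := isUnit_one_sub_diagonal_mul hW0 hW1 hlam hP
  have hdet := (Matrix.isUnit_iff_isUnit_det _).1 hu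
  refine ⟨fun i j => ?_, fun i => ?_⟩
  · refine nonneg_of_mulVec_nonneg hW0 hW1 hlam hP
      (x := fun k => ((1 - Matrix.diagonal lam * W)⁻¹ * (1 - Matrix.diagonal lam)) k j)
      (fun k => ?_) i
    change 0 ≤ ((1 - Matrix.diagonal lam * W) *
      ((1 - Matrix.diagonal lam * W)⁻¹ * (1 - Matrix.diagonal lam))) k j
    rw [Matrix.mul_nonsing_inv_cancel_left _ _ hdet, Matrix.sub_apply, Matrix.one_apply,
      Matrix.diagonal_apply]
    split_ifs
    · exact sub_nonneg.2 (hlam k).2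
    · simp
  · have hone : (1 - Matrix.diagonal lam) *ᵥ (1 : Fin n → ℝ) =
        (1 - Matrix.diagonal lam * W) *ᵥ (1 : Fin n → ℝ) := by
      ext k
      rw [one_sub_diagonal_mul_mulVec, Matrix.sub_mulVec, Matrix.one_mulVec, Pi.sub_apply,
        Matrix.mulVec_diagonal]
      simp [hW1]
    have h : ((1 - Matrix.diagonal lam * W)⁻¹ * (1 - Matrix.diagonal lam)) *ᵥ
        (1 : Fin n → ℝ) = 1 := by
      rw [← Matrix.mulVec_mulVec, hone, Matrix.mulVec_mulVec, Matrix.nonsing_inv_mul _ hdet,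
        Matrix.one_mulVec]
    simpa [Matrix.mulVec, dotProduct] using congrFun h i
end

section
/- Let W be an n×n stochastic matrix and Λ = diag(λ₁,…,λₙ) with 0 ≤ λᵢ ≤ 1. The Friedkin-Johnsen model x(k+1) = ΛWx(k) + (I−Λ)u is convergent (for every initial condition x(0) ∈ ℝⁿ and every prejudice vector u ∈ ℝⁿ, the limit of x(k) as k → ∞ exists) if and only if the matrix ΛW is regular, i.e., the limit of (ΛW)^k as k → ∞ exists. -/
open Matrix Filter Topology

section PowerLimit

variable {n : Type*} [Fintype n] {A P : Matrix n n ℝ}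

lemma tendsto_mulVec_right {u : ℕ → Matrix n n ℝ}
    (h : Tendsto u atTop (𝓝 P)) (v : n → ℝ) :
    Tendsto (fun k => u k *ᵥ v) atTop (𝓝 (P *ᵥ v)) :=
  ((continuous_id.matrix_mulVec continuous_const).tendsto P).comp h

variable [DecidableEq n]

lemma mul_eq_of_tendsto_pow (h : Tendsto (fun k => A ^ k) atTop (𝓝 P)) : P * A = P := by
  refine tendsto_nhds_unique (h.mul_const A) ?_
  simpa only [Function.comp_def, pow_succ] using h.comp (tendsto_add_atTop_nat 1)

lemma mulVec_eq_of_tendsto_pow_of_fixed (h : Tendsto (fun k => A ^ k) atTop (𝓝 P))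
    {y : n → ℝ} (hy : A *ᵥ y = y) : P *ᵥ y = y := by
  refine tendsto_nhds_unique (tendsto_mulVec_right h y) ?_
  have hk : ∀ k : ℕ, A ^ k *ᵥ y = y := by
    intro k
    induction k with
    | zero => simp
    | succ k ih => rw [pow_succ, ← mulVec_mulVec, hy, ih]
  simp only [hk, tendsto_const_nhds]

lemma isIdempotent_of_tendsto_pow (h : Tendsto (fun k => A ^ k) atTop (𝓝 P)) : P * P = P := by
  refine tendsto_nhds_unique (h.const_mul P) ?_
  have hk : ∀ k : ℕ, P * A ^ k = P := by
    intro k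
    induction k with
    | zero => simp
    | succ k ih => rw [pow_succ, ← mul_assoc, ih, mul_eq_of_tendsto_pow h]
  simp only [hk, tendsto_const_nhds]

/-- The kernel of the limit of the powers of `A` is contained in the range of `1 - A`. -/
lemma exists_sub_mulVec_eq_of_tendsto_pow (h : Tendsto (fun k => A ^ k) atTop (𝓝 P))
    {v : n → ℝ} (hv : P *ᵥ v = 0) : ∃ y, y - A *ᵥ y = v := by
  have hPS : ∀ y, P *ᵥ ((1 - A + P) *ᵥ y) = P *ᵥ y := by
    intro y
    rw [mulVec_mulVec, mul_add, mul_sub, mul_one, mul_eq_of_tendsto_pow h,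
      isIdempotent_of_tendsto_pow h, sub_self, zero_add]
  have hS : ∀ y, P *ᵥ y = 0 → (1 - A + P) *ᵥ y = y - A *ᵥ y := by
    intro y hy
    rw [add_mulVec, sub_mulVec, one_mulVec, hy, add_zero]
  have hinj : Function.Injective (1 - A + P).mulVecLin := by
    refine (injective_iff_map_eq_zero _).2 fun y hy => ?_
    rw [mulVecLin_apply] at hy
    have hPy : P *ᵥ y = 0 := by rw [← hPS y, hy, mulVec_zero]
    rw [hS y hPy, sub_eq_zero] at hy
    rw [← mulVec_eq_of_tendsto_pow_of_fixed h hy.symm, hPy]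
  obtain ⟨y, hy⟩ := LinearMap.injective_iff_surjective.1 hinj v
  rw [mulVecLin_apply] at hy
  have hPy : P *ᵥ y = 0 := by rw [← hPS y, hy, hv]
  exact ⟨y, by rw [← hS y hPy, hy]⟩

/-- An affine recursion with regular matrix converges if the limit of the powers annihilates
the constant term. -/
lemma exists_tendsto_of_affine_recursion (h : Tendsto (fun k => A ^ k) atTop (𝓝 P))
    {v : n → ℝ} (hv : P *ᵥ v = 0) {x : ℕ → n → ℝ} (hx : ∀ k, x (k + 1) = A *ᵥ x k + v) :
    ∃ l, Tendsto x atTop (𝓝 l) := by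
  obtain ⟨y, rfl⟩ := exists_sub_mulVec_eq_of_tendsto_pow h hv
  have hk : ∀ k, x k = A ^ k *ᵥ (x 0 - y) + y := by
    intro k
    induction k with
    | zero => simp
    | succ k ih =>
      rw [hx, ih, pow_succ', ← mulVec_mulVec, mulVec_add]
      abel
  refine ⟨P *ᵥ (x 0 - y) + y, ?_⟩
  exact ((tendsto_mulVec_right h _).add_const y).congr fun k => (hk k).symm

lemma nonneg_of_tendsto_pow (hA : ∀ i j, 0 ≤ A i j)
    (h : Tendsto (fun k => A ^ k) atTop (𝓝 P)) (i j : n) : 0 ≤ P i j := by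
  have hk : ∀ (k : ℕ) (i j : n), 0 ≤ (A ^ k) i j := by
    intro k
    induction k with
    | zero =>
      intro i j
      rw [pow_zero, one_apply]
      split_ifs <;> norm_num
    | succ k ih =>
      intro i j
      rw [pow_succ, mul_apply]
      exact Finset.sum_nonneg fun l _ => mul_nonneg (ih i l) (hA l j)
  exact ge_of_tendsto' (tendsto_pi_nhds.1 (tendsto_pi_nhds.1 h i) j) fun k => hk k i j

/-- For a stochastic `W` and weights in `[0, 1]`, the limit of the powers of `diagonal lam * W`
vanishes on the columns of index `j` with `lam j < 1`. -/
lemma mul_one_sub_diagonal_eq_zero {W : Matrix n n ℝ} {lam : n → ℝ}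
    (hW0 : ∀ i j, 0 ≤ W i j) (hW1 : ∀ i, ∑ j, W i j = 1)
    (hlam : ∀ i, 0 ≤ lam i ∧ lam i ≤ 1)
    (h : Tendsto (fun k => (diagonal lam * W) ^ k) atTop (𝓝 P)) :
    P * (1 - diagonal lam) = 0 := by
  have hP : ∀ i j, 0 ≤ P i j := nonneg_of_tendsto_pow
    (fun i j => by rw [diagonal_mul]; exact mul_nonneg (hlam i).1 (hW0 i j)) h
  have hone : (diagonal lam * W) *ᵥ 1 = lam := by
    ext i
    simp [mulVec, dotProduct, diagonal_mul, ← Finset.mul_sum, hW1]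
  have hPlam : P *ᵥ lam = P *ᵥ 1 := by
    rw [← hone, mulVec_mulVec, mul_eq_of_tendsto_pow h]
  ext i j
  have hsum : ∑ l, P i l * (1 - lam l) = 0 := by
    have := congrFun hPlam i
    simp only [mulVec, dotProduct, Pi.one_apply] at this
    simp only [mul_sub, Finset.sum_sub_distrib, this, sub_self]
  have hz := (Finset.sum_eq_zero_iff_of_nonneg fun l _ =>
    mul_nonneg (hP i l) (sub_nonneg.2 (hlam l).2)).1 hsum j (Finset.mem_univ j)
  rw [mul_sub, mul_one, Matrix.sub_apply, mul_diagonal, Matrix.zero_apply, ← hz]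
  ring

lemma exists_tendsto_pow_of_forall_mulVec
    (h : ∀ v : n → ℝ, ∃ l, Tendsto (fun k => A ^ k *ᵥ v) atTop (𝓝 l)) :
    ∃ P, Tendsto (fun k => A ^ k) atTop (𝓝 P) := by
  choose l hl using h
  refine ⟨of fun i j => l (Pi.single j 1) i, ?_⟩
  refine tendsto_pi_nhds.2 fun i => tendsto_pi_nhds.2 fun j => ?_
  simpa using tendsto_pi_nhds.1 (hl (Pi.single j 1)) i

end PowerLimit

theorem stmt10 {n : ℕ} (W : Matrix (Fin n) (Fin n) ℝ)
    (hW0 : ∀ i j, 0 ≤ W i j) (hW1 : ∀ i, ∑ j, W i j = 1)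
    (lam : Fin n → ℝ) (hlam : ∀ i, 0 ≤ lam i ∧ lam i ≤ 1) :
    (∀ (u : Fin n → ℝ) (x : ℕ → Fin n → ℝ),
      (∀ k, x (k + 1) =
        (Matrix.diagonal lam * W) *ᵥ x k + (1 - Matrix.diagonal lam) *ᵥ u) →
      ∃ xinf : Fin n → ℝ, Tendsto x atTop (𝓝 xinf)) ↔
    ∃ P : Matrix (Fin n) (Fin n) ℝ,
      Tendsto (fun k => (Matrix.diagonal lam * W) ^ k) atTop (𝓝 P) := by
  constructor
  · intro h
    refine exists_tendsto_pow_of_forall_mulVec fun v => h 0 _ fun k => ?_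
    rw [pow_succ', ← mulVec_mulVec, mulVec_zero, add_zero]
  · rintro ⟨P, hP⟩ u x hx
    refine exists_tendsto_of_affine_recursion hP ?_ hx
    rw [mulVec_mulVec, mul_one_sub_diagonal_eq_zero hW0 hW1 hlam hP, zero_mulVec]
end

section
/- Let W be an n×n stochastic matrix and Λ = diag(λ₁,…,λₙ) with 0 ≤ λᵢ ≤ 1. If p ∈ ℝⁿ is a nonnegative vector satisfying pᵀΛW = pᵀ, then pᵢ = 0 for every P-dependent agent i. Consequently, if every agent is P-dependent, the only nonnegative left eigenvector of ΛW with eigenvalue 1 is the zero vector. -/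
open Matrix

theorem vecMul_diagonal_mul_apply {n : ℕ} (W : Matrix (Fin n) (Fin n) ℝ) (lam p : Fin n → ℝ)
    (j : Fin n) :
    Matrix.vecMul p (Matrix.diagonal lam * W) j = ∑ i, p i * lam i * W i j := by
  simp [Matrix.vecMul, dotProduct, Matrix.diagonal_mul, mul_assoc]

theorem mul_diagonal_eq_self_of_vecMul_eq {n : ℕ} {W : Matrix (Fin n) (Fin n) ℝ}
    (hW1 : ∀ i, ∑ j, W i j = 1) {lam : Fin n → ℝ} (hlam : ∀ i, lam i ≤ 1)
    {p : Fin n → ℝ} (hp : ∀ i, 0 ≤ p i)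
    (heig : Matrix.vecMul p (Matrix.diagonal lam * W) = p) (i : Fin n) :
    p i * lam i = p i := by
  have hsum : ∑ i, p i * lam i = ∑ i, p i := by
    calc ∑ i, p i * lam i = ∑ i, ∑ j, p i * lam i * W i j := by
          simp [← Finset.mul_sum, hW1]
      _ = ∑ j, ∑ i, p i * lam i * W i j := Finset.sum_comm
      _ = ∑ j, p j := Finset.sum_congr rfl fun j _ => by
          rw [← vecMul_diagonal_mul_apply, heig]
  exact (Finset.sum_eq_sum_iff_of_le fun i _ => mul_le_of_le_one_right (hp i) (hlam i)).1
    hsum i (Finset.mem_univ i)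

theorem stmt12 {n : ℕ} (W : Matrix (Fin n) (Fin n) ℝ)
    (hW0 : ∀ i j, 0 ≤ W i j) (hW1 : ∀ i, ∑ j, W i j = 1)
    (lam : Fin n → ℝ) (hlam : ∀ i, 0 ≤ lam i ∧ lam i ≤ 1)
    (p : Fin n → ℝ) (hp : ∀ i, 0 ≤ p i)
    (heig : Matrix.vecMul p (Matrix.diagonal lam * W) = p) :
    (∀ i, PDepFJ W lam i → p i = 0) ∧ ((∀ i, PDepFJ W lam i) → p = 0) := by
  have hfix := mul_diagonal_eq_self_of_vecMul_eq hW1 (fun i => (hlam i).2) hp heig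
  have hzero : ∀ i, PDepFJ W lam i → p i = 0 := by
    rintro i ⟨j, hij, hj⟩
    induction hij using Relation.ReflTransGen.head_induction_on with
    | refl => exact (mul_right_eq_self₀.1 (hfix j)).resolve_left hj.ne
    | @head a b hab _ hb =>
      have hsum : ∑ i, p i * lam i * W i b = 0 := by
        rw [← vecMul_diagonal_mul_apply, heig, hb]
      have hterm := (Finset.sum_eq_zero_iff_of_nonneg fun i _ =>
        mul_nonneg (mul_nonneg (hp i) (hlam i).1) (hW0 i b)).1 hsum a (Finset.mem_univ a)
      rw [hfix a] at hterm
      exact (mul_eq_zero.1 hterm).resolve_right (ne_of_gt hab)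
  exact ⟨hzero, fun h => funext fun i => hzero i (h i)⟩
end

section
/- Let A be an n×n nonnegative real matrix, L[A] its Laplacian, and Γ = diag(γ₁,…,γₙ) with γᵢ ≥ 0. If p ∈ ℝⁿ is a nonnegative vector satisfying pᵀ(L[A]+Γ) = 0, then pᵢ = 0 for every P-dependent agent i. Consequently, if every agent is P-dependent, the only nonnegative vector p with pᵀ(L[A]+Γ) = 0 is the zero vector. -/
open Matrix

theorem Lap_mulVec_one {n : ℕ} (A : Matrix (Fin n) (Fin n) ℝ) : Lap A *ᵥ 1 = 0 := by
  ext i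
  simp only [mulVec, dotProduct_one, Pi.zero_apply]
  rw [← Finset.add_sum_erase _ _ (Finset.mem_univ i)]
  have h : ∑ j ∈ Finset.univ.erase i, Lap A i j = ∑ j ∈ Finset.univ.erase i, -A i j :=
    Finset.sum_congr rfl fun j hj => by simp [Lap, (Finset.ne_of_mem_erase hj).symm]
  rw [h, Finset.sum_neg_distrib]
  simp [Lap]

section LeftKernel

variable {n : ℕ} {A : Matrix (Fin n) (Fin n) ℝ} {γ p : Fin n → ℝ}

/-- Vanishing of the row sums of the Laplacian forces a nonnegative left null vector of
`Lap A + diagonal γ` to be orthogonal to `γ` entrywise. -/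
theorem mul_eq_zero_of_vecMul_Lap_add_diagonal_eq_zero (hγ : ∀ i, 0 ≤ γ i) (hp : ∀ i, 0 ≤ p i)
    (h : p ᵥ* (Lap A + diagonal γ) = 0) (j : Fin n) : p j * γ j = 0 := by
  have hsum : ∑ i, p i * γ i = 0 := by
    have h1 : p ⬝ᵥ ((Lap A + diagonal γ) *ᵥ 1) = 0 := by
      rw [dotProduct_mulVec, h, zero_dotProduct]
    rw [add_mulVec, Lap_mulVec_one, zero_add] at h1
    simpa [dotProduct, mulVec_diagonal] using h1
  exact (Finset.sum_eq_zero_iff_of_nonneg fun i _ => mul_nonneg (hp i) (hγ i)).1 hsum j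
    (Finset.mem_univ j)

/-- Zeros of a nonnegative left null vector propagate backwards along the arcs of `A`. -/
theorem eq_zero_of_vecMul_Lap_add_diagonal_eq_zero (hA : ∀ i j, 0 ≤ A i j) (hp : ∀ i, 0 ≤ p i)
    (h : p ᵥ* (Lap A + diagonal γ) = 0) {i j : Fin n} (hij : 0 < A i j) (hj : p j = 0) :
    p i = 0 := by
  have hsum : ∑ k, p k * A k j = 0 := by
    have hcol : ∑ k, p k * (Lap A + diagonal γ) k j = 0 := congrFun h j
    rw [← neg_eq_zero, ← Finset.sum_neg_distrib, ← hcol]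
    refine Finset.sum_congr rfl fun k _ => ?_
    by_cases hkj : k = j
    · simp [hkj, hj]
    · simp [Lap, hkj]
  have hi := (Finset.sum_eq_zero_iff_of_nonneg fun k _ => mul_nonneg (hp k) (hA k j)).1 hsum i
    (Finset.mem_univ i)
  exact (mul_eq_zero.1 hi).resolve_right hij.ne'

end LeftKernel

theorem stmt13 {n : ℕ} (A : Matrix (Fin n) (Fin n) ℝ) (hA : ∀ i j, 0 ≤ A i j)
    (γ : Fin n → ℝ) (hγ : ∀ i, 0 ≤ γ i)
    (p : Fin n → ℝ) (hp : ∀ i, 0 ≤ p i)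
    (heig : Matrix.vecMul p (Lap A + Matrix.diagonal γ) = 0) :
    (∀ i, PDep A γ i → p i = 0) ∧ ((∀ i, PDep A γ i) → p = 0) := by
  have hdep : ∀ i, PDep A γ i → p i = 0 := by
    rintro i ⟨j, hpath, hj⟩
    induction hpath using Relation.ReflTransGen.head_induction_on with
    | refl =>
      exact (mul_eq_zero.1 (mul_eq_zero_of_vecMul_Lap_add_diagonal_eq_zero hγ hp heig j)
        ).resolve_right hj.ne'
    | head hstep _ ih => exact eq_zero_of_vecMul_Lap_add_diagonal_eq_zero hA hp heig hstep ih
  exact ⟨hdep, fun hall => funext fun i => hdep i (hall i)⟩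
end

section
/- Let W be an n×n stochastic matrix and m ∈ (0,1). Then for every initial probability row vector p(0)ᵀ, the PageRank iteration p(k+1)ᵀ = (1−m) p(k)ᵀ W + (m/n) 𝟙ₙᵀ converges as k → ∞ to the unique limit (m/n) 𝟙ₙᵀ (I − (1−m)W)⁻¹, which is independent of p(0); in particular I − (1−m)W is invertible. -/
open Matrix Filter Topology

section

open scoped Matrix.Norms.Operator

/-- The sup-row-sum norm of a scaled stochastic matrix is at most the absolute scale. -/
lemma norm_smul_stochastic_le {ι : Type*} [Fintype ι] [DecidableEq ι] (W : Matrix ι ι ℝ)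
    (hW0 : ∀ i j, 0 ≤ W i j) (hW1 : ∀ i, ∑ j, W i j = 1) (c : ℝ) : ‖c • W‖ ≤ |c| := by
  have hW : ‖W‖ ≤ 1 := by
    rw [Matrix.linfty_opNorm_def]
    refine NNReal.coe_le_one.2 (Finset.sup_le fun i _ => ?_)
    rw [← NNReal.coe_le_coe]
    simp [abs_of_nonneg (hW0 i _), hW1 i]
  calc ‖c • W‖ ≤ ‖c‖ * ‖W‖ := norm_smul_le c W
    _ ≤ |c| := mul_le_of_le_one_right (abs_nonneg c) hW

lemma isUnit_one_sub_smul_stochastic {ι : Type*} [Fintype ι] [DecidableEq ι] (W : Matrix ι ι ℝ)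
    (hW0 : ∀ i j, 0 ≤ W i j) (hW1 : ∀ i, ∑ j, W i j = 1) {c : ℝ} (hc : |c| < 1) :
    IsUnit (1 - c • W) :=
  isUnit_one_sub_of_norm_lt_one ((norm_smul_stochastic_le W hW0 hW1 c).trans_lt hc)

lemma tendsto_pow_smul_stochastic {ι : Type*} [Fintype ι] [DecidableEq ι] (W : Matrix ι ι ℝ)
    (hW0 : ∀ i j, 0 ≤ W i j) (hW1 : ∀ i, ∑ j, W i j = 1) {c : ℝ} (hc : |c| < 1) :
    Tendsto (fun k : ℕ => (c • W) ^ k) atTop (𝓝 0) :=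
  tendsto_pow_atTop_nhds_zero_of_norm_lt_one
    ((norm_smul_stochastic_le W hW0 hW1 c).trans_lt hc)

end

/-- An affine recursion on row vectors converges to its fixed point when the powers of its
linear part tend to zero. -/
lemma tendsto_affine_recursion {ι : Type*} [Fintype ι] [DecidableEq ι] {A : Matrix ι ι ℝ}
    (hA : IsUnit (1 - A)) (hpow : Tendsto (fun k : ℕ => A ^ k) atTop (𝓝 0))
    (b : ι → ℝ) (p : ℕ → ι → ℝ) (hp : ∀ k, p (k + 1) = p k ᵥ* A + b) :
    Tendsto p atTop (𝓝 (b ᵥ* (1 - A)⁻¹)) := by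
  set q := b ᵥ* (1 - A)⁻¹ with hq
  have hfix : q = q ᵥ* A + b := by
    have h : q ᵥ* (1 - A) = b := by
      rw [hq, Matrix.vecMul_vecMul,
        Matrix.nonsing_inv_mul _ ((Matrix.isUnit_iff_isUnit_det _).1 hA), Matrix.vecMul_one]
    rw [Matrix.vecMul_sub, Matrix.vecMul_one] at h
    rw [← h]
    abel
  have hsub : ∀ k, p k = (p 0 - q) ᵥ* A ^ k + q := by
    intro k
    induction k with
    | zero => simp
    | succ k ih =>
      rw [hp, ih, Matrix.add_vecMul, Matrix.vecMul_vecMul, ← pow_succ, add_assoc, ← hfix]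
  have hlim : Tendsto (fun k => (p 0 - q) ᵥ* A ^ k + q) atTop
      (𝓝 ((p 0 - q) ᵥ* (0 : Matrix ι ι ℝ) + q)) :=
    (((continuous_const.matrix_vecMul continuous_id).tendsto _).comp hpow).add_const q
  rw [Matrix.vecMul_zero, zero_add] at hlim
  rwa [funext hsub]

theorem stmt16 {n : ℕ} (hn : 0 < n) (W : Matrix (Fin n) (Fin n) ℝ)
    (hW0 : ∀ i j, 0 ≤ W i j) (hW1 : ∀ i, ∑ j, W i j = 1)
    (m : ℝ) (hm : 0 < m ∧ m < 1) :
    IsUnit (1 - (1 - m) • W) ∧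
    ∀ p : ℕ → Fin n → ℝ,
      (∀ i, 0 ≤ p 0 i) → (∑ i, p 0 i = 1) →
      (∀ k, p (k + 1) =
        (1 - m) • Matrix.vecMul (p k) W + fun _ => m / n) →
      Tendsto p atTop
        (𝓝 (Matrix.vecMul (fun _ => m / n) (1 - (1 - m) • W)⁻¹)) := by
  have hc : |1 - m| < 1 := abs_lt.2 ⟨by linarith [hm.2], by linarith [hm.1]⟩
  have hU := isUnit_one_sub_smul_stochastic W hW0 hW1 hc
  refine ⟨hU, fun p _ _ hp => ?_⟩
  refine tendsto_affine_recursion hU (tendsto_pow_smul_stochastic W hW0 hW1 hc) _ p fun k => ?_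
  rw [hp k, Matrix.vecMul_smul]
end
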